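/- Let X_S and X_M be independent random variables with CDFs F_S(x) = 1 - exp(-2λ_S x) and F_M(x) = 1 - exp(-λ_M π x²) for x ≥ 0, where λ_S, λ_M > 0, let α_S, α_M > 0 and 0 < B < A, and suppose ℙ(Case 2) > 0 where Case 2 = {B·X_M^{-α_M} < X_S^{-α_S} < A·X_M^{-α_M}}. Then for every x ≥ 0 the conditional distribution of the serving-SBS (uplink) distance satisfies ℙ(X_S > x | Case 2) = (1/ℙ(Case 2)) · ∫_x^∞ [exp(-λ_M π B^{2/α_M} u^{2α_S/α_M}) - exp(-λ_M π A^{2/α_M} u^{2α_S/α_M})] · 2λ_S exp(-2λ_S u) du. -/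

import Mathlib

open MeasureTheory ProbabilityTheory Real Set

/-- A probability measure on `ℝ` with Rayleigh-type distribution function `t ↦ 1 - exp (-c t²)`
on the nonnegative half-line: mass of an open interval. -/
lemma measure_Ioo_of_measure_Iic_eq_one_sub_exp (ν : Measure ℝ) [IsProbabilityMeasure ν] {c : ℝ}
    (hc : 0 ≤ c)
    (hν : ∀ t : ℝ, 0 ≤ t → ν (Iic t) = ENNReal.ofReal (1 - Real.exp (-(c * t ^ 2))))
    {a b : ℝ} (ha : 0 ≤ a) (hab : a < b) :
    ν (Ioo a b) = ENNReal.ofReal (Real.exp (-(c * a ^ 2)) - Real.exp (-(c * b ^ 2))) := by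
  have hcdf : ∀ t : ℝ, 0 ≤ t → cdf ν t = 1 - Real.exp (-(c * t ^ 2)) := fun t ht ↦ by
    rw [cdf_eq_real, measureReal_def, hν t ht, ENNReal.toReal_ofReal]
    have : 0 ≤ c * t ^ 2 := by positivity
    simpa using this
  have hlim : Function.leftLim (cdf ν) b = 1 - Real.exp (-(c * b ^ 2)) := by
    refine leftLim_eq_of_tendsto ?_
    have hcont : Continuous fun t : ℝ ↦ 1 - Real.exp (-(c * t ^ 2)) := by fun_prop
    refine (hcont.continuousAt.tendsto.mono_left nhdsWithin_le_nhds).congr' ?_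
    filter_upwards [Ioo_mem_nhdsLT hab] with t ht
    exact (hcdf t (ha.trans ht.1.le)).symm
  rw [← measure_cdf ν, StieltjesFunction.measure_Ioo, hlim, hcdf a ha]
  congr 1
  ring

/-- A measurable real random variable with the exponential distribution function has the
exponential law. -/
lemma map_eq_expMeasure_of_measure_le {Ω : Type*} [MeasurableSpace Ω] {μ : Measure Ω}
    [IsProbabilityMeasure μ] {X : Ω → ℝ} (hX : Measurable X) {r : ℝ} (hr : 0 < r)
    (hF : ∀ x : ℝ, 0 ≤ x → μ {ω | X ω ≤ x} = ENNReal.ofReal (1 - Real.exp (-(r * x))))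
    (hFneg : ∀ x : ℝ, x < 0 → μ {ω | X ω ≤ x} = 0) :
    μ.map X = expMeasure r := by
  have := Measure.isProbabilityMeasure_map (μ := μ) hX.aemeasurable
  have := isProbabilityMeasure_expMeasure hr
  refine Measure.ext_of_Iic _ _ fun x ↦ ?_
  rw [Measure.map_apply hX measurableSet_Iic, ← ofReal_cdf (expMeasure r), cdf_expMeasure_eq hr]
  split_ifs with h
  · exact hF x h
  · exact (hFneg x (not_le.1 h)).trans ENNReal.ofReal_zero.symm

lemma setLIntegral_expMeasure {r x : ℝ} (hx : 0 ≤ x) {f : ℝ → ENNReal} (hf : Measurable f) :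
    ∫⁻ u in Ioi x, f u ∂expMeasure r
      = ∫⁻ u in Ioi x, f u * ENNReal.ofReal (r * Real.exp (-(r * u))) := by
  have hpdf : Measurable (exponentialPDF r) :=
    (measurable_exponentialPDFReal r).ennreal_ofReal
  change ∫⁻ u in Ioi x, f u ∂volume.withDensity (exponentialPDF r) = _
  rw [setLIntegral_withDensity_eq_setLIntegral_mul _ hpdf hf measurableSet_Ioi]
  refine setLIntegral_congr_fun measurableSet_Ioi fun u hu ↦ ?_
  simp only [Pi.mul_apply]
  rw [exponentialPDF_of_nonneg (hx.trans (le_of_lt hu)), mul_comm]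

section PathLoss

variable {K u v a b : ℝ}

lemma rpow_bias_mul_rpow_pow (hK : 0 < K) (hu : 0 < u) (hb : 0 < b) :
    (K ^ (1 / b) * u ^ (a / b)) ^ b = K * u ^ a := by
  rw [Real.mul_rpow (by positivity) (by positivity), ← Real.rpow_mul hK.le, ← Real.rpow_mul hu.le,
    one_div_mul_cancel hb.ne', div_mul_cancel₀ _ hb.ne', Real.rpow_one]

lemma mul_rpow_neg_lt_rpow_neg_iff (hK : 0 < K) (hu : 0 < u) (hv : 0 < v) (hb : 0 < b) :
    K * v ^ (-b) < u ^ (-a) ↔ K ^ (1 / b) * u ^ (a / b) < v := by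
  rw [← Real.rpow_lt_rpow_iff (by positivity) hv.le hb, rpow_bias_mul_rpow_pow hK hu hb,
    Real.rpow_neg hv.le, Real.rpow_neg hu.le, ← div_eq_mul_inv, ← one_div,
    div_lt_div_iff₀ (by positivity) (by positivity), one_mul]

lemma rpow_neg_lt_mul_rpow_neg_iff (hK : 0 < K) (hu : 0 < u) (hv : 0 < v) (hb : 0 < b) :
    u ^ (-a) < K * v ^ (-b) ↔ v < K ^ (1 / b) * u ^ (a / b) := by
  rw [← Real.rpow_lt_rpow_iff hv.le (by positivity) hb, rpow_bias_mul_rpow_pow hK hu hb,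
    Real.rpow_neg hv.le, Real.rpow_neg hu.le, ← div_eq_mul_inv, ← one_div,
    div_lt_div_iff₀ (by positivity) (by positivity), one_mul]

lemma rpow_bias_mul_rpow_sq (hK : 0 < K) (hu : 0 < u) :
    (K ^ (1 / b) * u ^ (a / b)) ^ 2 = K ^ (2 / b) * u ^ (2 * a / b) := by
  rw [mul_pow, ← Real.rpow_mul_natCast hK.le, ← Real.rpow_mul_natCast hu.le]
  congr 2 <;> push_cast <;> ring

end PathLoss

theorem case2_serving_SBS_distance_distribution
    {Ω : Type*} [MeasurableSpace Ω] (μ : Measure Ω) [IsProbabilityMeasure μ]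
    (XS XM : Ω → ℝ) (hXSm : Measurable XS) (hXMm : Measurable XM)
    (hindep : IndepFun XS XM μ)
    (lamS lamM αS αM A B : ℝ)
    (hlamS : 0 < lamS) (hlamM : 0 < lamM)
    (hαS : 0 < αS) (hαM : 0 < αM) (hB : 0 < B) (hBA : B < A)
    (hFS : ∀ x : ℝ, 0 ≤ x →
      μ {ω | XS ω ≤ x} = ENNReal.ofReal (1 - Real.exp (-(2 * lamS * x))))
    (hFSneg : ∀ x : ℝ, x < 0 → μ {ω | XS ω ≤ x} = 0)
    (hFM : ∀ x : ℝ, 0 ≤ x →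
      μ {ω | XM ω ≤ x} = ENNReal.ofReal (1 - Real.exp (-(lamM * π * x ^ 2))))
    (hFMneg : ∀ x : ℝ, x < 0 → μ {ω | XM ω ≤ x} = 0)
    (hpos : 0 < μ {ω | B * XM ω ^ (-αM) < XS ω ^ (-αS) ∧ XS ω ^ (-αS) < A * XM ω ^ (-αM)}) :
    ∀ x : ℝ, 0 ≤ x →
      μ[|{ω | B * XM ω ^ (-αM) < XS ω ^ (-αS) ∧ XS ω ^ (-αS) < A * XM ω ^ (-αM)}] {ω | x < XS ω}
        = ENNReal.ofReal
            ((μ {ω | B * XM ω ^ (-αM) < XS ω ^ (-αS) ∧ XS ω ^ (-αS) < A * XM ω ^ (-αM)}).toReal⁻¹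
              * ∫ u in Set.Ioi x,
                  (Real.exp (-(lamM * π * B ^ (2 / αM) * u ^ (2 * αS / αM)))
                    - Real.exp (-(lamM * π * A ^ (2 / αM) * u ^ (2 * αS / αM))))
                    * (2 * lamS * Real.exp (-(2 * lamS * u)))) := by
  intro x hx
  have hA : 0 < A := hB.trans hBA
  have hc : 0 < lamM * π := by positivity
  have hr : 0 < 2 * lamS := by positivity
  set C := {ω | B * XM ω ^ (-αM) < XS ω ^ (-αS) ∧ XS ω ^ (-αS) < A * XM ω ^ (-αM)} with hC
  set D : Set (ℝ × ℝ) :=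
    {p | B * p.2 ^ (-αM) < p.1 ^ (-αS) ∧ p.1 ^ (-αS) < A * p.2 ^ (-αM)} with hD
  have hDm : MeasurableSet D := by
    have hM : Measurable fun p : ℝ × ℝ ↦ p.2 ^ (-αM) := by fun_prop
    have hS : Measurable fun p : ℝ × ℝ ↦ p.1 ^ (-αS) := by fun_prop
    exact (measurableSet_lt (hM.const_mul B) hS).inter (measurableSet_lt hS (hM.const_mul A))
  have hCm : MeasurableSet C := (hXSm.prodMk hXMm) hDm
  have := Measure.isProbabilityMeasure_map (μ := μ) hXSm.aemeasurable
  have := Measure.isProbabilityMeasure_map (μ := μ) hXMm.aemeasurable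
  set ν := μ.map XM with hνdef
  have hν : ∀ t : ℝ, 0 ≤ t → ν (Iic t) = ENNReal.ofReal (1 - Real.exp (-(lamM * π * t ^ 2))) :=
    fun t ht ↦ by
      rw [hνdef, Measure.map_apply hXMm measurableSet_Iic]
      exact hFM t ht
  have hνpos : ∀ᵐ v ∂ν, 0 < v := by
    rw [ae_iff]
    simp only [not_lt]
    exact (hν 0 le_rfl).trans (by simp)
  set g : ℝ → ℝ := fun u ↦ Real.exp (-(lamM * π * B ^ (2 / αM) * u ^ (2 * αS / αM)))
    - Real.exp (-(lamM * π * A ^ (2 / αM) * u ^ (2 * αS / αM))) with hg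
  have hgm : Measurable g := by fun_prop
  have hg0 : ∀ u, 0 < u → 0 ≤ g u := fun u hu ↦ by
    have : B ^ (2 / αM) ≤ A ^ (2 / αM) := Real.rpow_le_rpow hB.le hBA.le (by positivity)
    simp only [hg, sub_nonneg]
    gcongr
  have hg1 : ∀ u, 0 < u → g u ≤ 1 := fun u hu ↦ by
    have h1 : Real.exp (-(lamM * π * B ^ (2 / αM) * u ^ (2 * αS / αM))) ≤ 1 :=
      Real.exp_le_one_iff.2 (neg_nonpos.2 (by positivity))
    have h2 := Real.exp_pos (-(lamM * π * A ^ (2 / αM) * u ^ (2 * αS / αM)))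
    simp only [hg]
    linarith
  have hslice : ∀ u, 0 < u → ν (Prod.mk u ⁻¹' D) = ENNReal.ofReal (g u) := fun u hu ↦ by
    have hae : Prod.mk u ⁻¹' D
        =ᵐ[ν] Ioo (B ^ (1 / αM) * u ^ (αS / αM)) (A ^ (1 / αM) * u ^ (αS / αM)) := by
      filter_upwards [hνpos] with v hv
      exact propext (and_congr (mul_rpow_neg_lt_rpow_neg_iff hB hu hv hαM)
        (rpow_neg_lt_mul_rpow_neg_iff hA hu hv hαM))
    have hlt : B ^ (1 / αM) < A ^ (1 / αM) := Real.rpow_lt_rpow hB.le hBA (by positivity)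
    rw [measure_congr hae, measure_Ioo_of_measure_Iic_eq_one_sub_exp ν hc.le hν (by positivity)
      (by gcongr), rpow_bias_mul_rpow_sq hB hu, rpow_bias_mul_rpow_sq hA hu]
    simp only [hg, mul_assoc]
  have hjoint : μ (C ∩ {ω | x < XS ω})
      = ∫⁻ u in Ioi x, ENNReal.ofReal (g u * (2 * lamS * Real.exp (-(2 * lamS * u)))) := by
    have hEm : MeasurableSet (D ∩ Prod.fst ⁻¹' Ioi x) :=
      hDm.inter (measurable_fst measurableSet_Ioi)
    have hpre : C ∩ {ω | x < XS ω}
        = (fun ω ↦ (XS ω, XM ω)) ⁻¹' (D ∩ Prod.fst ⁻¹' Ioi x) := rfl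
    have hind : ∀ u, ν (Prod.mk u ⁻¹' (D ∩ Prod.fst ⁻¹' Ioi x))
        = (Ioi x).indicator (fun u ↦ ENNReal.ofReal (g u)) u := fun u ↦ by
      by_cases hu : x < u
      · rw [indicator_of_mem (mem_Ioi.2 hu), ← hslice u (hx.trans_lt hu)]
        congr 1
        ext v
        simp [hu]
      · rw [indicator_of_notMem (by simpa using hu)]
        convert measure_empty (μ := ν)
        ext v
        simp [hu]
    rw [hpre, ← Measure.map_apply (hXSm.prodMk hXMm) hEm, hindep.map_prod_eq_prod_map_map
      hXSm.aemeasurable hXMm.aemeasurable, Measure.prod_apply hEm, lintegral_congr hind,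
      lintegral_indicator measurableSet_Ioi, map_eq_expMeasure_of_measure_le hXSm hr hFS hFSneg,
      setLIntegral_expMeasure hx hgm.ennreal_ofReal]
    refine setLIntegral_congr_fun measurableSet_Ioi fun u hu ↦ ?_
    exact (ENNReal.ofReal_mul (hg0 u (hx.trans_lt hu))).symm
  have hint : IntegrableOn (fun u ↦ g u * (2 * lamS * Real.exp (-(2 * lamS * u)))) (Ioi x) := by
    have hexp : IntegrableOn (fun u ↦ 2 * lamS * Real.exp (-(2 * lamS * u))) (Ioi x) := by
      simpa only [neg_mul] using! (exp_neg_integrableOn_Ioi x hr).const_mul (2 * lamS)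
    refine Integrable.mono' hexp (by fun_prop) ?_
    filter_upwards [ae_restrict_mem measurableSet_Ioi] with u hu
    have hu0 := hx.trans_lt hu
    rw [Real.norm_of_nonneg (mul_nonneg (hg0 u hu0) (by positivity))]
    exact mul_le_of_le_one_left (by positivity) (hg1 u hu0)
  have hnonneg : 0 ≤ᵐ[volume.restrict (Ioi x)]
      fun u ↦ g u * (2 * lamS * Real.exp (-(2 * lamS * u))) := by
    filter_upwards [ae_restrict_mem measurableSet_Ioi] with u hu
    exact mul_nonneg (hg0 u (hx.trans_lt hu)) (by positivity)
  rw [cond_apply hCm, hjoint, ENNReal.ofReal_mul (by positivity),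
    ofReal_integral_eq_lintegral_ofReal hint hnonneg,
    ENNReal.ofReal_inv_of_pos (ENNReal.toReal_pos hpos.ne' (measure_ne_top μ C)),
    ENNReal.ofReal_toReal (measure_ne_top μ C)]
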